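/- For every odd integer n ≥ 5, let γ_n := 4/((n+7)(n-1)). For every unate unbiased function f : {-1,1}^n → {-1,1} and every p with 0 < p < γ_n, it holds that Φ_p(Maj_n) ≥ Φ_p(f). -/

import Mathlib

open Finset

noncomputable def chi (b : Bool) : ℝ := if b then 1 else -1

noncomputable def maj (n : ℕ) (x : Fin n → Bool) : ℝ :=
  Real.sign (∑ i, chi (x i))

def eVec (n : ℕ) : Fin n → Bool := fun i => decide ((i : ℕ) < (n - 1) / 2 + 1)

noncomputable def gfun (n : ℕ) (x : Fin n → Bool) : ℝ :=
  if x = eVec n ∨ x = (fun i => !(eVec n i)) then - maj n x else maj n x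

noncomputable def stab (n : ℕ) (ρ : ℝ) (f : (Fin n → Bool) → ℝ) : ℝ :=
  (1 / 2 ^ n) * ∑ x : Fin n → Bool, ∑ z : Fin n → Bool,
    (∏ i, if z i then (1 - ρ) / 2 else (1 + ρ) / 2) * (f x * f (fun i => xor (x i) (z i)))

noncomputable def phi (n : ℕ) (p : ℝ) (f : (Fin n → Bool) → ℝ) : ℝ :=
  ∑ s : Fin n → Bool, (∏ i, if s i then p else 1 - p) *
    ((1 / 2 ^ n) * ∑ x : Fin n → Bool,
      |(1 / 2 ^ n) * ∑ z : Fin n → Bool, f (fun i => if s i then x i else z i)|)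

noncomputable def binomPMF (m : ℕ) (q : ℝ) (k : ℕ) : ℝ :=
  (m.choose k : ℝ) * q ^ k * (1 - q) ^ (m - k)

noncomputable def binomCollision (m : ℕ) (q : ℝ) : ℝ :=
  ∑ k ∈ Finset.range (m + 1), (binomPMF m q k) ^ 2

/-- The average of a real function over the cube. -/
noncomputable def avg {n : ℕ} (F : (Fin n → Bool) → ℝ) : ℝ := (1 / 2 ^ n) * ∑ x, F x

/-- The point agreeing with `x` on `s` and with `z` off `s`. -/
def mix {n : ℕ} (s x z : Fin n → Bool) : Fin n → Bool := fun i => if s i then x i else z i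

/-- The expected absolute value of `f` conditioned on the coordinates in `s`. -/
noncomputable def condAbs {n : ℕ} (s : Fin n → Bool) (f : (Fin n → Bool) → ℝ) : ℝ :=
  avg fun x => |avg fun z => f (mix s x z)|

/-- The degree-one Fourier coefficient. -/
noncomputable def coeff {n : ℕ} (f : (Fin n → Bool) → ℝ) (i : Fin n) : ℝ :=
  avg fun x => f x * chi (x i)

/-- The Fourier coefficient at a pair of distinct coordinates. -/
noncomputable def coeffPair {n : ℕ} (f : (Fin n → Bool) → ℝ) (i j : Fin n) : ℝ :=
  avg fun x => f x * (chi (x i) * chi (x j))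

section Avg

variable {n : ℕ} (F G : (Fin n → Bool) → ℝ)

lemma avg_add : avg (fun x => F x + G x) = avg F + avg G := by
  simp only [avg, sum_add_distrib, mul_add]

lemma avg_sub : avg (fun x => F x - G x) = avg F - avg G := by
  simp only [avg, sum_sub_distrib, mul_sub]

lemma avg_const_mul (c : ℝ) : avg (fun x => c * F x) = c * avg F := by
  simp only [avg, ← mul_sum]; ring

lemma avg_const (c : ℝ) : avg (fun _ : Fin n → Bool => c) = c := by
  simp [avg]

lemma avg_sum {ι : Type*} (s : Finset ι) (H : ι → (Fin n → Bool) → ℝ) :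
    avg (fun x => ∑ i ∈ s, H i x) = ∑ i ∈ s, avg (H i) := by
  simp only [avg, ← mul_sum]; rw [sum_comm]

variable {F G} in
lemma avg_mono (h : ∀ x, F x ≤ G x) : avg F ≤ avg G :=
  mul_le_mul_of_nonneg_left (sum_le_sum fun x _ => h x) (by positivity)

lemma abs_avg_le : |avg F| ≤ avg fun x => |F x| := by
  unfold avg
  rw [abs_mul, abs_of_nonneg (by positivity : (0 : ℝ) ≤ 1 / 2 ^ n)]
  exact mul_le_mul_of_nonneg_left (abs_sum_le_sum_abs _ _) (by positivity)

lemma avg_comp_equiv (e : (Fin n → Bool) ≃ (Fin n → Bool)) : avg (fun x => F (e x)) = avg F := by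
  unfold avg; rw [Equiv.sum_comp e F]

lemma avg_avg_mix (s : Fin n → Bool) : avg (fun x => avg fun z => F (mix s x z)) = avg F := by
  have hinv : Function.Involutive
      (fun q : (Fin n → Bool) × (Fin n → Bool) => (mix s q.1 q.2, mix s q.2 q.1)) := by
    rintro ⟨x, z⟩
    simp only [Prod.mk.injEq]
    constructor <;> (funext i; by_cases h : s i <;> simp [mix, h])
  have key : ∑ x, ∑ z, F (mix s x z) = ∑ x : Fin n → Bool, ∑ _z : Fin n → Bool, F x := by
    rw [← Fintype.sum_prod_type', ← Fintype.sum_prod_type']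
    exact Equiv.sum_comp hinv.toPerm (fun q => F q.1)
  calc avg (fun x => avg fun z => F (mix s x z))
      = (1 / 2 ^ n) * ((1 / 2 ^ n) * ∑ x, ∑ z, F (mix s x z)) := by
        simp only [avg, ← mul_sum]
    _ = avg F := by rw [key]; simp [avg, ← mul_sum]

end Avg

lemma chi_sq (b : Bool) : chi b * chi b = 1 := by cases b <;> simp [chi]

lemma chi_not (b : Bool) : chi (!b) = -chi b := by cases b <;> simp [chi]

lemma abs_chi (b : Bool) : |chi b| = 1 := by cases b <;> simp [chi]

lemma abs_chi_sub (a b : Bool) : |chi a - chi b| = 1 - chi a * chi b := by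
  cases a <;> cases b <;> norm_num [chi]

lemma phi_eq_sum_condAbs {n : ℕ} (p : ℝ) (f : (Fin n → Bool) → ℝ) :
    phi n p f = ∑ s : Fin n → Bool, (∏ i, if s i then p else 1 - p) * condAbs s f := rfl

section CondAbs

variable {n : ℕ} (f : (Fin n → Bool) → ℝ) (s : Fin n → Bool)

lemma avg_mul_le_condAbs (g : (Fin n → Bool) → ℝ) (hg : ∀ x, |g x| ≤ 1)
    (hs : ∀ x z, g (mix s x z) = g x) : avg (fun x => f x * g x) ≤ condAbs s f := by
  rw [← avg_avg_mix _ s]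
  refine avg_mono fun x => ?_
  have : avg (fun z => f (mix s x z) * g (mix s x z)) = g x * avg fun z => f (mix s x z) := by
    rw [← avg_const_mul]; congr 1; funext z; rw [hs]; ring
  rw [this]
  calc g x * avg (fun z => f (mix s x z)) ≤ |g x * avg (fun z => f (mix s x z))| := le_abs_self _
    _ = |g x| * |avg (fun z => f (mix s x z))| := abs_mul _ _
    _ ≤ 1 * |avg (fun z => f (mix s x z))| :=
        mul_le_mul_of_nonneg_right (hg x) (abs_nonneg _)
    _ = _ := one_mul _

lemma exists_condAbs_eq : ∃ g : (Fin n → Bool) → ℝ, (∀ x, |g x| ≤ 1) ∧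
    (∀ x y, (∀ i, s i = true → x i = y i) → g x = g y) ∧
    condAbs s f = avg fun x => f x * g x := by
  have hmix : ∀ x y z, (∀ i, s i = true → x i = y i) → mix s x z = mix s y z := by
    intro x y z h
    funext i
    by_cases hi : s i = true
    · simp [mix, hi, h i hi]
    · simp [mix, hi]
  refine ⟨fun x => if 0 ≤ avg (fun z => f (mix s x z)) then 1 else -1, ?_, ?_, ?_⟩
  · intro x; dsimp only; split_ifs <;> simp
  · intro x y h; simp only [hmix x y _ h]
  · rw [← avg_avg_mix (fun x => f x * _) s]
    unfold condAbs
    congr 1; funext x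
    have h : ∀ z z', mix s (mix s x z) z' = mix s x z' := by
      intro z z'; funext i; by_cases hi : s i <;> simp [mix, hi]
    simp only [h]
    split_ifs with h0
    · rw [abs_of_nonneg h0]; simp
    · rw [abs_of_neg (not_le.mp h0)]
      have := avg_const_mul (fun z => f (mix s x z)) (-1)
      simp only [mul_neg, mul_one, neg_mul, one_mul] at this ⊢
      exact this.symm

lemma condAbs_nonneg : 0 ≤ condAbs s f := by
  have := avg_mul_le_condAbs f s (fun _ => 0) (by simp) (by simp)
  simpa [avg_const] using this

lemma condAbs_le_add_avg_abs_sub (g : (Fin n → Bool) → ℝ) :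
    condAbs s f ≤ condAbs s g + avg fun x => |f x - g x| := by
  obtain ⟨k, hk1, hk2, hk3⟩ := exists_condAbs_eq f s
  have h1 := avg_mul_le_condAbs g s k hk1 fun x z => hk2 _ _ fun i hi => by simp [mix, hi]
  have h2 : avg (fun x => f x * k x) - avg (fun x => g x * k x) ≤ avg fun x => |f x - g x| := by
    rw [← avg_sub]
    refine avg_mono fun x => ?_
    calc f x * k x - g x * k x ≤ |(f x - g x) * k x| := by rw [← sub_mul]; exact le_abs_self _
      _ = |f x - g x| * |k x| := abs_mul _ _
      _ ≤ |f x - g x| * 1 := mul_le_mul_of_nonneg_left (hk1 x) (abs_nonneg _)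
      _ = _ := mul_one _
  linarith

end CondAbs

/-- The indicator vector of a set of coordinates. -/
def bits {n : ℕ} (S : Finset (Fin n)) : Fin n → Bool := fun i => decide (i ∈ S)

lemma prod_bits {n : ℕ} (p : ℝ) (S : Finset (Fin n)) :
    (∏ i, if bits S i then p else 1 - p) = p ^ #S * (1 - p) ^ (n - #S) := by
  have h : (univ.filter fun i => i ∉ S) = Sᶜ := by ext; simp
  simp [bits, prod_ite, h, card_compl]

lemma sum_eq_sum_bits {n : ℕ} (F : (Fin n → Bool) → ℝ) : ∑ s, F s = ∑ S, F (bits S) := by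
  symm
  refine Fintype.sum_bijective bits ⟨?_, ?_⟩ _ _ fun _ => rfl
  · intro S T h
    ext i
    have := congrFun h i
    simpa [bits] using this
  · intro s
    exact ⟨univ.filter fun i => s i = true, by funext i; simp [bits]⟩

lemma sum_offDiag_pair {ι : Type*} [Fintype ι] [DecidableEq ι] (G : Finset ι → ℝ) :
    ∑ q ∈ (univ : Finset ι).offDiag, G {q.1, q.2} = 2 * ∑ S ∈ powersetCard 2 univ, G S := by
  have hmaps : ∀ q ∈ (univ : Finset ι).offDiag,
      ({q.1, q.2} : Finset ι) ∈ powersetCard 2 (univ : Finset ι) := by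
    intro q hq
    rw [mem_powersetCard]
    exact ⟨subset_univ _, card_pair (by simpa using hq)⟩
  rw [← sum_fiberwise_of_maps_to hmaps, mul_sum]
  refine sum_congr rfl fun S hS => ?_
  obtain ⟨a, b, hab, rfl⟩ := card_eq_two.mp (mem_powersetCard.mp hS).2
  have hfib : ((univ : Finset ι).offDiag.filter fun q => ({q.1, q.2} : Finset ι) = {a, b})
      = {(a, b), (b, a)} := by
    ext ⟨c, e⟩
    simp only [mem_filter, mem_offDiag, mem_univ, true_and, mem_insert, mem_singleton,
      Prod.mk.injEq]
    constructor
    · rintro ⟨hne, h⟩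
      have h1 : c ∈ ({a, b} : Finset ι) := by rw [← h]; simp
      have h2 : e ∈ ({a, b} : Finset ι) := by rw [← h]; simp
      simp only [mem_insert, mem_singleton] at h1 h2
      grind
    · rintro (⟨rfl, rfl⟩ | ⟨rfl, rfl⟩)
      · exact ⟨hab, rfl⟩
      · exact ⟨hab.symm, pair_comm _ _⟩
  rw [hfib, sum_pair (by simp [hab])]
  simp only [pair_comm b a]
  ring

lemma sum_weight_ge {n : ℕ} (hn : 2 ≤ n) {p : ℝ} (hp0 : 0 ≤ p) (hp1 : p ≤ 1)
    (G : (Fin n → Bool) → ℝ) (hG : ∀ s, 0 ≤ G s) :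
    (1 - p) ^ n * G (bits ∅) + p * (1 - p) ^ (n - 1) * ∑ i, G (bits {i}) +
      p ^ 2 * (1 - p) ^ (n - 2) * ((1 / 2) * ∑ q ∈ univ.offDiag, G (bits {q.1, q.2})) ≤
    ∑ s : Fin n → Bool, (∏ i, if s i then p else 1 - p) * G s := by
  have hq : 0 ≤ 1 - p := by linarith
  rw [sum_eq_sum_bits, ← powerset_univ, sum_powerset]
  have hsub : range 3 ⊆ range (#(univ : Finset (Fin n)) + 1) := by
    intro k; simp; omega
  refine le_trans (le_of_eq ?_) (sum_le_sum_of_subset_of_nonneg hsub fun k _ _ =>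
    sum_nonneg fun S _ => ?_)
  · have h2 : ∑ S ∈ powersetCard 2 (univ : Finset (Fin n)),
        (∏ i, if bits S i then p else 1 - p) * G (bits S)
        = p ^ 2 * (1 - p) ^ (n - 2) * ∑ S ∈ powersetCard 2 univ, G (bits S) := by
      rw [mul_sum]
      refine sum_congr rfl fun S hS => ?_
      rw [prod_bits, (mem_powersetCard.mp hS).2]
    rw [sum_offDiag_pair fun S => G (bits S), sum_range_succ, sum_range_succ, sum_range_one, h2,
      powersetCard_one, powersetCard_zero, sum_singleton, sum_map]
    simp only [prod_bits, Function.Embedding.coeFn_mk, card_singleton, card_empty, pow_zero,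
      pow_one, Nat.sub_zero, one_mul, ← mul_sum]
    ring
  · rw [prod_bits]
    have := hG (bits S)
    positivity

lemma sum_weight {n : ℕ} (p : ℝ) :
    ∑ s : Fin n → Bool, (∏ i, if s i then p else 1 - p) = 1 := by
  rw [← Fintype.prod_sum (fun (_ : Fin n) (b : Bool) => if b then p else 1 - p)]
  simp

lemma one_le_binomial_head (p : ℝ) (hp0 : 0 ≤ p) (hp1 : p ≤ 1) (m : ℕ) :
    1 ≤ (1 - p) ^ (m + 2) + (m + 2) * p * (1 - p) ^ (m + 1) +
      (m + 2) * (m + 1) / 2 * p ^ 2 * (1 - p) ^ m + (m + 2) * (m + 1) * m / 6 * p ^ 3 := by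
  induction m with
  | zero => norm_num; nlinarith
  | succ m ih =>
    have h : (1 - p) ^ m ≤ 1 := pow_le_one₀ (by linarith) (by linarith)
    have h2 : ((m : ℝ) + 2) * (m + 1) / 2 * p ^ 3 * (1 - p) ^ m ≤
        ((m : ℝ) + 2) * (m + 1) / 2 * p ^ 3 * 1 := mul_le_mul_of_nonneg_left h (by positivity)
    push_cast
    refine ih.trans ?_
    rw [← sub_nonneg] at h2 ⊢
    refine h2.trans (le_of_eq ?_)
    ring

section PairBounds

variable {n : ℕ} {f : (Fin n → Bool) → ℝ}

lemma avg_mul_chi_nonneg (i : Fin n)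
    (hmono : ∀ x : Fin n → Bool, f (Function.update x i false) ≤ f (Function.update x i true))
    (k : (Fin n → Bool) → ℝ) (hk : ∀ x, 0 ≤ k x)
    (hki : ∀ x b, k (Function.update x i b) = k x) :
    0 ≤ avg fun x => f x * chi (x i) * k x := by
  have hinv : Function.Involutive (fun x : Fin n → Bool => Function.update x i (!x i)) := by
    intro x; simp
  have h1 := avg_comp_equiv (fun x => f x * chi (x i) * k x) hinv.toPerm
  have h2 := avg_add (fun x => f x * chi (x i) * k x)
    (fun x => f (hinv.toPerm _ x) * chi (hinv.toPerm _ x i) * k (hinv.toPerm _ x))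
  have h3 : 0 ≤ avg fun x => f x * chi (x i) * k x +
      f (hinv.toPerm _ x) * chi (hinv.toPerm _ x i) * k (hinv.toPerm _ x) := by
    rw [← avg_const (n := n) 0]
    refine avg_mono fun x => ?_
    have hm := hmono x
    have hx : Function.update x i (x i) = x := Function.update_eq_self i x
    simp only [Function.Involutive.coe_toPerm, hki, Function.update_self, chi_not]
    have hk' := hk x
    cases hb : x i <;> rw [hb] at hx <;> simp only [Bool.not_true, Bool.not_false, chi] <;>
      rw [hx] at hm <;> norm_num <;> nlinarith
  linarith

lemma coeff_nonneg (i : Fin n)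
    (hmono : ∀ x : Fin n → Bool, f (Function.update x i false) ≤ f (Function.update x i true)) :
    0 ≤ coeff f i := by
  simpa [coeff] using avg_mul_chi_nonneg i hmono (fun _ => 1) (by simp) (by simp)

lemma abs_coeffPair_le (i j : Fin n) (hij : i ≠ j)
    (hmono : ∀ x : Fin n → Bool, f (Function.update x i false) ≤ f (Function.update x i true)) :
    |coeffPair f i j| ≤ coeff f i := by
  have hk : ∀ b, |chi b| ≤ 1 := fun b => (abs_chi b).le
  have h1 := avg_mul_chi_nonneg i hmono (fun x => 1 - chi (x j))
    (fun x => by linarith [(abs_le.mp (hk (x j))).2])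
    (fun x b => by simp [Function.update_of_ne hij.symm])
  have h2 := avg_mul_chi_nonneg i hmono (fun x => 1 + chi (x j))
    (fun x => by linarith [(abs_le.mp (hk (x j))).1])
    (fun x b => by simp [Function.update_of_ne hij.symm])
  simp only [mul_add, mul_sub, avg_add, avg_sub, mul_one, mul_assoc] at h1 h2
  rw [abs_le]
  unfold coeffPair coeff
  constructor <;> linarith

lemma condAbs_empty (hbias : avg f = 0) : condAbs (bits ∅) f = 0 := by
  obtain ⟨g, -, hg, h⟩ := exists_condAbs_eq f (bits ∅)
  have hc : ∀ x, g x = g fun _ => true := fun x => hg _ _ (by simp [bits])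
  have h2 := avg_const_mul f (g fun _ => true)
  rw [h, ← mul_zero (g fun _ => true), ← hbias, ← h2]
  congr 1; funext x; rw [hc x, mul_comm]

lemma condAbs_singleton_le (hbias : avg f = 0) (i : Fin n) (h0 : 0 ≤ coeff f i) :
    condAbs (bits {i}) f ≤ coeff f i := by
  obtain ⟨g, hg1, hg, h⟩ := exists_condAbs_eq f (bits {i})
  have ht := abs_le.mp (hg1 fun _ => true)
  have hf := abs_le.mp (hg1 fun _ => false)
  set a := g fun _ => true
  set b := g fun _ => false
  have hexp : ∀ x, f x * g x = (a + b) / 2 * f x + (a - b) / 2 * (f x * chi (x i)) := by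
    intro x
    have : g x = g fun _ => x i := hg _ _ (by simp [bits])
    rw [this]
    cases x i <;> simp only [chi, a, b] <;> norm_num <;> ring
  rw [h]
  simp only [hexp]
  rw [avg_add, avg_const_mul, avg_const_mul, hbias]
  change _ * 0 + _ * coeff f i ≤ _
  nlinarith

lemma condAbs_pair_le (hbias : avg f = 0) (i j : Fin n) (hij : i ≠ j)
    (hi : |coeffPair f i j| ≤ coeff f i) (hj : 0 ≤ coeff f j) {M : ℝ}
    (hM1 : |coeff f i - coeff f j| ≤ M) (hM2 : |coeffPair f i j| ≤ M) :
    condAbs (bits {i, j}) f ≤ (coeff f i + coeff f j) / 2 + M / 2 := by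
  obtain ⟨g, hg1, hg, h⟩ := exists_condAbs_eq f (bits {i, j})
  let G : Bool → Bool → ℝ := fun a b => g fun k => if k = i then a else b
  have hG : ∀ a b, |G a b| ≤ 1 := fun a b => hg1 _
  have hexp : ∀ x, f x * g x =
      (G true true + G true false + G false true + G false false) / 4 * f x +
      ((G true true + G true false - G false true - G false false) / 4 * (f x * chi (x i)) +
      ((G true true - G true false + G false true - G false false) / 4 * (f x * chi (x j)) +
      (G true true - G true false - G false true + G false false) / 4 *
        (f x * (chi (x i) * chi (x j))))) := by
    intro x
    have : g x = G (x i) (x j) := by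
      refine hg _ _ fun k hk => ?_
      simp only [bits, mem_insert, mem_singleton, decide_eq_true_eq] at hk
      rcases hk with rfl | rfl
      · simp
      · simp [hij.symm]
    rw [this]
    cases x i <;> cases x j <;> simp only [chi] <;> norm_num <;> ring
  rw [h]
  simp only [hexp]
  rw [avg_add, avg_add, avg_add, avg_const_mul, avg_const_mul, avg_const_mul, avg_const_mul, hbias]
  change _ * 0 + (_ * coeff f i + (_ * coeff f j + _ * coeffPair f i j)) ≤ _
  generalize coeff f i = u at *
  generalize coeff f j = v at *
  generalize coeffPair f i j = w at *
  have key : ∀ g c : ℝ, |g| ≤ 1 → g * c ≤ |c| := by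
    intro g c hg
    calc g * c ≤ |g * c| := le_abs_self _
      _ = |g| * |c| := abs_mul _ _
      _ ≤ 1 * |c| := mul_le_mul_of_nonneg_right hg (abs_nonneg _)
      _ = _ := one_mul _
  have k1 := key _ (u + v + w) (hG true true)
  have k2 := key _ (u - v - w) (hG true false)
  have k3 := key _ (-u + v - w) (hG false true)
  have k4 := key _ (-u - v + w) (hG false false)
  rw [abs_le] at hi hM1 hM2
  rw [abs_of_nonneg (by linarith)] at k1
  rw [abs_of_nonpos (by linarith)] at k4
  have k5 : |u - v - w| + |-u + v - w| ≤ 2 * M := by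
    rcases abs_cases (u - v - w) with ⟨e1, -⟩ | ⟨e1, -⟩ <;>
      rcases abs_cases (-u + v - w) with ⟨e2, -⟩ | ⟨e2, -⟩ <;> (rw [e1, e2]; linarith)
  linarith

lemma coeff_le_condAbs (f : (Fin n → Bool) → ℝ) (i : Fin n) :
    coeff f i ≤ condAbs (bits {i}) f :=
  avg_mul_le_condAbs f _ (fun x => chi (x i)) (fun x => (abs_chi _).le)
    (fun x z => by simp [mix, bits])

lemma coeff_add_le_condAbs (f : (Fin n → Bool) → ℝ) (i j : Fin n) :
    (coeff f i + coeff f j) / 2 ≤ condAbs (bits {i, j}) f := by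
  refine le_trans (le_of_eq ?_) (avg_mul_le_condAbs f _ (fun x => (chi (x i) + chi (x j)) / 2)
    (fun x => ?_) (fun x z => by simp [mix, bits]))
  · have h : ∀ x, f x * ((chi (x i) + chi (x j)) / 2)
        = (1 / 2) * (f x * chi (x i) + f x * chi (x j)) := fun x => by ring
    simp only [h]
    rw [avg_const_mul, avg_add]
    unfold coeff; ring
  · cases x i <;> cases x j <;> norm_num [chi]

end PairBounds

section Majority

variable {n : ℕ}

lemma one_le_abs_sum_chi (hodd : Odd n) (x : Fin n → Bool) : 1 ≤ |∑ i, chi (x i)| := by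
  have h : ∑ i, chi (x i) = ((2 * (#(univ.filter fun i => x i = true) : ℤ) - n : ℤ) : ℝ) := by
    have hc : ∀ b, chi b = 2 * (if b = true then 1 else 0) - 1 := by
      intro b; cases b <;> norm_num [chi]
    simp only [hc, sum_sub_distrib, ← mul_sum, sum_boole]
    simp
  rw [h, ← Int.cast_abs]
  have : (1 : ℤ) ≤ |2 * (#(univ.filter fun i => x i = true) : ℤ) - n| := by
    apply Int.one_le_abs
    obtain ⟨m, hm⟩ := hodd
    omega
  exact_mod_cast this

lemma abs_sub_maj_le (hodd : Odd n) (x : Fin n → Bool) {a : ℝ} (ha : a = 1 ∨ a = -1) :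
    |a - maj n x| ≤ (maj n x - a) * ∑ i, chi (x i) := by
  have h := one_le_abs_sum_chi hodd x
  unfold maj
  rcases le_abs.mp h with h | h
  · rw [Real.sign_of_pos (by linarith)]
    rcases ha with rfl | rfl <;> norm_num <;> linarith
  · rw [Real.sign_of_neg (by linarith)]
    rcases ha with rfl | rfl <;> norm_num <;> linarith

lemma maj_not (x : Fin n → Bool) : maj n (fun i => !x i) = -maj n x := by
  simp [maj, chi_not, Real.sign_neg]

lemma maj_comp_perm (σ : Equiv.Perm (Fin n)) (x : Fin n → Bool) : maj n (x ∘ σ) = maj n x := by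
  unfold maj
  congr 1
  exact Equiv.sum_comp σ fun i => chi (x i)

lemma avg_odd_eq_zero (F : (Fin n → Bool) → ℝ) (hF : ∀ x, F (fun i => !x i) = -F x) :
    avg F = 0 := by
  have hinv : Function.Involutive (fun (x : Fin n → Bool) i => !x i) := by
    intro x; simp
  have h := avg_comp_equiv F hinv.toPerm
  have h2 := avg_const_mul F (-1)
  simp only [Function.Involutive.coe_toPerm, hF] at h
  simp only [neg_mul, one_mul] at h2
  linarith

lemma avg_maj : avg (maj n) = 0 := avg_odd_eq_zero _ maj_not

lemma coeffPair_maj (i j : Fin n) : coeffPair (maj n) i j = 0 :=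
  avg_odd_eq_zero _ fun x => by simp only [maj_not, chi_not]; ring

lemma coeff_maj_eq (i j : Fin n) : coeff (maj n) i = coeff (maj n) j := by
  have h := avg_comp_equiv (fun x => maj n x * chi (x i))
    ((Equiv.swap i j).arrowCongr (Equiv.refl Bool))
  have h2 : ∀ x : Fin n → Bool, (Equiv.swap i j).arrowCongr (Equiv.refl Bool) x
      = x ∘ Equiv.swap i j := fun x => rfl
  simp only [h2, maj_comp_perm, Function.comp_apply, Equiv.swap_apply_left] at h
  exact h.symm

end Majority

section Comparison

variable {n : ℕ} {f : (Fin n → Bool) → ℝ}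

lemma avg_abs_sub_maj_le (hodd : Odd n) (hf : ∀ x, f x = 1 ∨ f x = -1) :
    avg (fun x => |f x - maj n x|) ≤ ∑ i, (coeff (maj n) i - coeff f i) := by
  have h : ∑ i, (coeff (maj n) i - coeff f i)
      = avg fun x => (maj n x - f x) * ∑ i, chi (x i) := by
    simp only [mul_sum, avg_sum, sub_mul, avg_sub, coeff]
  rw [h]
  exact avg_mono fun x => abs_sub_maj_le hodd x (hf x)

lemma abs_coeff_sub_le (i j : Fin n) : |coeff f i - coeff f j| ≤
    avg fun x => |f x - maj n x| * (1 - chi (x i) * chi (x j)) := by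
  have h : coeff f i - coeff f j
      = avg fun x => (f x - maj n x) * (chi (x i) - chi (x j)) := by
    have hm := coeff_maj_eq i j
    simp only [sub_mul, mul_sub, avg_sub]
    simp only [coeff] at hm ⊢
    linarith
  rw [h]
  refine (abs_avg_le _).trans (le_of_eq ?_)
  simp only [abs_mul, abs_chi_sub]

lemma abs_coeffPair_le_avg (hbias : avg f = 0) (i j : Fin n) : |coeffPair f i j| ≤
    avg fun x => |f x - maj n x| * (1 - chi (x i) * chi (x j)) := by
  have h : coeffPair f i j
      = avg fun x => (f x - maj n x) * (chi (x i) * chi (x j) - 1) := by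
    have hm := coeffPair_maj i j
    have hb := avg_maj (n := n)
    simp only [sub_mul, mul_sub, avg_sub, mul_one]
    simp only [coeffPair] at hm ⊢
    linarith
  rw [h]
  refine (abs_avg_le _).trans (le_of_eq ?_)
  congr 1; funext x
  rw [abs_mul, ← abs_chi_sub, abs_sub_comm _ (1 : ℝ), ← abs_chi_sub, abs_abs]

lemma sum_avg_disagree_le (hodd : Odd n) (F : (Fin n → Bool) → ℝ) (hF : ∀ x, 0 ≤ F x) :
    ∑ i, ∑ j, avg (fun x => F x * (1 - chi (x i) * chi (x j))) ≤
      ((n : ℝ) ^ 2 - 1) * avg F := by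
  simp only [← avg_sum]
  rw [← avg_const_mul]
  refine avg_mono fun x => ?_
  have h : ∑ i, ∑ j, F x * (1 - chi (x i) * chi (x j))
      = F x * ((n : ℝ) ^ 2 - (∑ i, chi (x i)) ^ 2) := by
    simp only [← mul_sum, sum_sub_distrib, ← sum_mul]
    simp; left; ring
  rw [h, mul_comm]
  have := one_le_abs_sum_chi hodd x
  have h2 : 1 ≤ (∑ i, chi (x i)) ^ 2 := by rw [← sq_abs]; nlinarith
  exact mul_le_mul_of_nonneg_right (by linarith) (hF x)

lemma sum_pair_condAbs_sub_ge (hodd : Odd n) (hbias : avg f = 0)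
    (hmono : ∀ (i : Fin n) x, f (Function.update x i false) ≤ f (Function.update x i true)) :
    ((n : ℝ) - 1) * ∑ i, (coeff (maj n) i - coeff f i) -
      ((n : ℝ) ^ 2 - 1) / 2 * avg (fun x => |f x - maj n x|) ≤
    ∑ q ∈ univ.offDiag, (condAbs (bits {q.1, q.2}) (maj n) - condAbs (bits {q.1, q.2}) f) := by
  set D : Fin n → ℝ := fun i => coeff (maj n) i - coeff f i
  set M : Fin n → Fin n → ℝ :=
    fun i j => avg fun x => |f x - maj n x| * (1 - chi (x i) * chi (x j))
  have hterm : ∀ q ∈ (univ : Finset (Fin n)).offDiag, (D q.1 + D q.2) / 2 - M q.1 q.2 / 2 ≤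
      condAbs (bits {q.1, q.2}) (maj n) - condAbs (bits {q.1, q.2}) f := by
    rintro ⟨i, j⟩ hq
    have hij : i ≠ j := by simpa using hq
    have h1 := condAbs_pair_le hbias i j hij (abs_coeffPair_le i j hij (hmono i))
      (coeff_nonneg j (hmono j)) (abs_coeff_sub_le i j) (abs_coeffPair_le_avg hbias i j)
    have h2 := coeff_add_le_condAbs (maj n) i j
    simp only [D, M]
    linarith
  refine le_trans ?_ (sum_le_sum hterm)
  have hsplit := sum_union (disjoint_diag_offDiag (univ : Finset (Fin n)))
    (f := fun q : Fin n × Fin n => (D q.1 + D q.2) / 2 - M q.1 q.2 / 2)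
  rw [diag_union_offDiag, sum_product, sum_diag] at hsplit
  have hdiag : ∀ i, M i i = 0 := fun i => by simp [M, chi_sq, avg_const]
  have hall : ∑ i, ∑ j, ((D i + D j) / 2 - M i j / 2)
      = n * ∑ i, D i - (∑ i, ∑ j, M i j) / 2 := by
    simp only [sum_sub_distrib, ← sum_div, sum_add_distrib]
    simp [← mul_sum]
  have hM := sum_avg_disagree_le hodd (fun x => |f x - maj n x|) fun x => abs_nonneg _
  change ∑ i, ∑ j, M i j ≤ _ at hM
  simp only [hdiag, hall, add_self_div_two, zero_div, sub_zero] at hsplit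
  linarith

end Comparison

lemma numeric_bound {n : ℕ} (hn : 5 ≤ n) {p : ℝ} (hp0 : 0 < p)
    (hp1 : p < 4 / (((n : ℝ) + 7) * ((n : ℝ) - 1))) :
    1 ≤ (1 - p) ^ n + ((n : ℝ) + 1) * (p * (1 - p) ^ (n - 1)) +
      ((n : ℝ) * (n - 1) / 2 + (n - 1) / 2 - ((n : ℝ) ^ 2 - 1) / 4) *
        (p ^ 2 * (1 - p) ^ (n - 2)) := by
  obtain ⟨m, rfl⟩ : ∃ m, n = m + 2 := ⟨n - 2, by omega⟩
  have hm : (3 : ℝ) ≤ m := by exact_mod_cast (by omega : 3 ≤ m)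
  push_cast at hp1 ⊢
  rw [lt_div_iff₀ (by nlinarith)] at hp1
  have hple : p * (m + 9) ≤ 1 := by nlinarith
  have hp : p ≤ 1 := by nlinarith
  have hhead := one_le_binomial_head p hp0.le hp m
  have hbern : 1 - m * p ≤ (1 - p) ^ m := by
    have := one_add_mul_le_pow (a := -p) (by linarith) m
    simpa [sub_eq_add_neg] using this
  have hmain : (m + 2) * (m + 1) * m / 6 * p ^ 2 ≤
      (1 - p) ^ m * (1 - p - p * (m + 1) ^ 2 / 4) := by
    have hpow : 2 / 3 ≤ (1 - p) ^ m := by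
      refine le_trans ?_ hbern
      have : 3 * m * (p * ((m + 9) * (m + 1))) ≤ 1 * ((m + 9) * (m + 1)) := by nlinarith
      have : 3 * m * p ≤ 1 := by
        refine le_of_mul_le_mul_right ?_ (by positivity : (0 : ℝ) < (m + 9) * (m + 1))
        linarith
      linarith
    have hbracket : 7 ≤ (m + 9) * (1 - p - p * (m + 1) ^ 2 / 4) := by nlinarith
    have hsq : (p * ((m + 9) * (m + 1))) ^ 2 ≤ 16 := by
      have : 0 ≤ p * (((m : ℝ) + 9) * (m + 1)) := by positivity
      nlinarith
    have hcube : ((m : ℝ) + 2) * (m + 1) * m * (m + 9) ≤ ((m + 9) * (m + 1)) ^ 2 := by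
      have h1 : ((m : ℝ) + 2) * m ≤ (m + 9) * (m + 1) := by nlinarith
      have := mul_le_mul_of_nonneg_right h1 (by positivity : (0 : ℝ) ≤ (m + 9) * (m + 1))
      linarith
    have htail := mul_le_mul_of_nonneg_left hcube (sq_nonneg p)
    refine le_of_mul_le_mul_left ?_ (by positivity : (0 : ℝ) < m + 9)
    nlinarith
  have := mul_le_mul_of_nonneg_left hmain hp0.le
  rw [← sub_nonneg] at this
  refine hhead.trans ?_
  rw [← sub_nonneg]
  refine this.trans (le_of_eq ?_)
  ring

lemma phi_le_phi_maj_of_monotone {n : ℕ} (hodd : Odd n) (hn : 5 ≤ n)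
    {f : (Fin n → Bool) → ℝ} (hf : ∀ x, f x = 1 ∨ f x = -1)
    (hmono : ∀ (i : Fin n) x, f (Function.update x i false) ≤ f (Function.update x i true))
    (hbias : avg f = 0) {p : ℝ} (hp0 : 0 < p)
    (hp1 : p < 4 / (((n : ℝ) + 7) * ((n : ℝ) - 1))) : phi n p f ≤ phi n p (maj n) := by
  have hn' : (5 : ℝ) ≤ n := by exact_mod_cast hn
  have hp : p ≤ 1 := by
    refine hp1.le.trans ((div_le_one (by nlinarith)).mpr ?_)
    nlinarith
  set d := avg fun x => |f x - maj n x|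
  set D := ∑ i, (coeff (maj n) i - coeff f i)
  have hd : 0 ≤ d := by
    have := avg_mono (n := n) (F := fun _ => 0) (G := fun x => |f x - maj n x|)
      fun x => abs_nonneg _
    rwa [avg_const] at this
  have hdD : d ≤ D := avg_abs_sub_maj_le hodd hf
  let G : (Fin n → Bool) → ℝ := fun s => condAbs s (maj n) - condAbs s f + d
  have hG : ∀ s, 0 ≤ G s := fun s => by
    have := condAbs_le_add_avg_abs_sub f s (maj n)
    simp only [G]
    linarith
  have hsum : ∑ s : Fin n → Bool, (∏ i, if s i then p else 1 - p) * G s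
      = phi n p (maj n) - phi n p f + d := by
    simp only [G, mul_add, mul_sub, sum_add_distrib, sum_sub_distrib, ← sum_mul, sum_weight,
      ← phi_eq_sum_condAbs, one_mul]
  have hge := sum_weight_ge (by omega) hp0.le hp G hG
  rw [hsum] at hge
  have hempty : d ≤ G (bits ∅) := by
    have := condAbs_nonneg (maj n) (bits ∅)
    simp only [G, condAbs_empty hbias]
    linarith
  have hsingle : D + n * d ≤ ∑ i, G (bits {i}) := by
    have h1 : D + n * d = ∑ i : Fin n, (coeff (maj n) i - coeff f i + d) := by
      simp [D, sum_add_distrib]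
    rw [h1]
    refine sum_le_sum fun i _ => ?_
    have h2 := coeff_le_condAbs (maj n) i
    have h3 := condAbs_singleton_le hbias i (coeff_nonneg i (hmono i))
    simp only [G]
    linarith
  have hpair : ((n : ℝ) - 1) * D - ((n : ℝ) ^ 2 - 1) / 2 * d + n * (n - 1) * d ≤
      ∑ q ∈ univ.offDiag, G (bits {q.1, q.2}) := by
    have h1 := sum_pair_condAbs_sub_ge hodd hbias hmono
    have h2 : (#(univ : Finset (Fin n)).offDiag : ℝ) = n * (n - 1) := by
      rw [offDiag_card, Nat.cast_sub (Nat.le_mul_self _)]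
      simp; ring
    simp only [G, sum_add_distrib, sum_const, nsmul_eq_mul, h2]
    linarith
  have hq : 0 ≤ 1 - p := by linarith
  have hw0 : 0 ≤ (1 - p) ^ n := by positivity
  have hw1 : 0 ≤ p * (1 - p) ^ (n - 1) := by positivity
  have hw2 : 0 ≤ p ^ 2 * (1 - p) ^ (n - 2) := by positivity
  have hnum := mul_le_mul_of_nonneg_left (numeric_bound hn hp0 hp1) hd
  have hnD : ((n : ℝ) - 1) * d ≤ ((n : ℝ) - 1) * D :=
    mul_le_mul_of_nonneg_left hdD (by linarith)
  have e0 := mul_le_mul_of_nonneg_left hempty hw0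
  have e1 := mul_le_mul_of_nonneg_left
    (le_trans (by linarith : ((n : ℝ) + 1) * d ≤ D + n * d) hsingle) hw1
  have e2 := mul_le_mul_of_nonneg_left (mul_le_mul_of_nonneg_left
    (le_trans (by linarith : ((n : ℝ) - 1) * d - ((n : ℝ) ^ 2 - 1) / 2 * d + n * (n - 1) * d ≤ _)
      hpair) (by norm_num : (0 : ℝ) ≤ 1 / 2)) hw2
  linarith

lemma xor_coordinates_involutive {n : ℕ} (t : Fin n → Bool) :
    Function.Involutive (fun (x : Fin n → Bool) i => xor (x i) (t i)) := by
  intro x; simp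

lemma avg_comp_xor {n : ℕ} (t : Fin n → Bool) (F : (Fin n → Bool) → ℝ) :
    avg (fun x => F fun i => xor (x i) (t i)) = avg F :=
  avg_comp_equiv F ((xor_coordinates_involutive t).toPerm _)

lemma phi_comp_xor {n : ℕ} (p : ℝ) (t : Fin n → Bool) (f : (Fin n → Bool) → ℝ) :
    phi n p (fun x => f fun i => xor (x i) (t i)) = phi n p f := by
  simp only [phi_eq_sum_condAbs]
  refine sum_congr rfl fun s _ => ?_
  congr 1
  unfold condAbs
  have h : ∀ x z : Fin n → Bool, (fun i => xor (mix s x z i) (t i))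
      = mix s (fun i => xor (x i) (t i)) (fun i => xor (z i) (t i)) := by
    intro x z; funext i; by_cases hi : s i <;> simp [mix, hi]
  simp only [h]
  rw [← avg_comp_xor t fun x => |avg fun z => f (mix s x z)|]
  congr 1; funext x
  rw [← avg_comp_xor t fun z => f (mix s _ z)]

lemma update_xor {n : ℕ} (t x : Fin n → Bool) (i : Fin n) (b : Bool) :
    (fun k => xor (Function.update x i b k) (t k))
      = Function.update (fun k => xor (x k) (t k)) i (xor b (t i)) := by
  funext k
  by_cases h : k = i
  · subst h; simp
  · simp [h]

theorem stmt8 (n : ℕ) (hodd : Odd n) (hn : 5 ≤ n)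
    (f : (Fin n → Bool) → ℝ) (hf : ∀ x, f x = 1 ∨ f x = -1)
    (hunate : ∀ i : Fin n,
      (∀ x : Fin n → Bool, f (Function.update x i false) ≤ f (Function.update x i true)) ∨
      (∀ x : Fin n → Bool, f (Function.update x i true) ≤ f (Function.update x i false)))
    (hbias : ∑ x : Fin n → Bool, f x = 0)
    (p : ℝ) (hp0 : 0 < p) (hp1 : p < 4 / (((n : ℝ) + 7) * ((n : ℝ) - 1))) :
    phi n p f ≤ phi n p (maj n) := by
  let t : Fin n → Bool := fun i =>
    !decide (∀ x : Fin n → Bool, f (Function.update x i false) ≤ f (Function.update x i true))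
  rw [← phi_comp_xor p t f]
  refine phi_le_phi_maj_of_monotone hodd hn (fun x => hf _) ?_ ?_ hp0 hp1
  · intro i x
    simp only [update_xor]
    by_cases h : ∀ x : Fin n → Bool,
        f (Function.update x i false) ≤ f (Function.update x i true)
    · have ht : t i = false := by simpa [t] using h
      simpa [ht] using h _
    · have ht : t i = true := by simpa [t] using h
      simpa [ht] using (hunate i).resolve_left h _
  · rw [avg_comp_xor t f, avg, hbias, mul_zero]
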